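/- arXiv:1103.4267 — 9 statements merged into one kernel-verified Lean document; each statement's English description precedes it below -/
import Mathlib

section
/- Let P ∈ ℂ[x₀,x₁,x₂] be a homogeneous polynomial such that the Jacobian Poisson structure π(P) is H-invariant (i.e. P ∈ 𝓗). Then σ·P = P, and every monomial occurring in P has τ-degree 0 (i.e. for every monomial x₀^{a₀}x₁^{a₁}x₂^{a₂} of P one has a₁ + 2a₂ ≡ 0 mod 3). -/
open MvPolynomial

/-- The primitive cube root of unity `ε = e^{2πi/3}`. -/
noncomputable def eps3 : ℂ := Complex.exp (2 * Real.pi * Complex.I / 3)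

/-- The algebra automorphism `σ` of `ℂ[x₀,x₁,x₂]` with `σ(x_i) = x_{i+1 mod 3}`. -/
noncomputable def sigma3 : MvPolynomial (Fin 3) ℂ →ₐ[ℂ] MvPolynomial (Fin 3) ℂ :=
  rename (fun i : Fin 3 => i + 1)

/-- The algebra endomorphism `τ` of `ℂ[x₀,x₁,x₂]` with `τ(x_i) = ε^i x_i`. -/
noncomputable def tau3 : MvPolynomial (Fin 3) ℂ →ₐ[ℂ] MvPolynomial (Fin 3) ℂ :=
  aeval (fun i : Fin 3 => C (eps3 ^ (i : ℕ)) * X i)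

/-- The Jacobian Poisson bracket `{x_i, x_j}` attached to the Casimir `P`:
for `(i,j,k)` a cyclic permutation of `(0,1,2)` one has `{x_i,x_j} = ∂P/∂x_k`,
extended antisymmetrically. -/
noncomputable def jb3 (P : MvPolynomial (Fin 3) ℂ) (i j : Fin 3) : MvPolynomial (Fin 3) ℂ :=
  if i = j then 0 else if j = i + 1 then pderiv (i + 2) P else -(pderiv (j + 2) P)

/-- `P ∈ 𝓗`: the Jacobian Poisson structure `π(P)` is Heisenberg-invariant. -/
def Hinv3 (P : MvPolynomial (Fin 3) ℂ) : Prop :=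
  ∀ i j : Fin 3,
    jb3 P (i + 1) (j + 1) = sigma3 (jb3 P i j) ∧
    tau3 (jb3 P i j) = eps3 ^ ((i : ℕ) + (j : ℕ)) • jb3 P i j

theorem eps3_isPrimitiveRoot : IsPrimitiveRoot eps3 3 := by
  simpa [eps3] using Complex.isPrimitiveRoot_exp 3 (by norm_num)

theorem jb3_add_one_add_two (P : MvPolynomial (Fin 3) ℂ) (k : Fin 3) :
    jb3 P (k + 1) (k + 2) = pderiv k P := by
  fin_cases k <;> simp [jb3]

theorem coeff_tau3 (p : MvPolynomial (Fin 3) ℂ) (m : Fin 3 →₀ ℕ) :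
    coeff m (tau3 p) = eps3 ^ (m 1 + 2 * m 2) * coeff m p := by
  induction p using MvPolynomial.induction_on' with
  | add p q hp hq => simp [hp, hq, mul_add]
  | monomial u a =>
    have h : tau3 (monomial u a) = monomial u (eps3 ^ (u 1 + 2 * u 2) * a) := by
      rw [tau3, aeval_monomial, monomial_eq, Finsupp.prod_fintype _ _ (by simp),
        Finsupp.prod_fintype _ _ (by simp)]
      simp only [Fin.prod_univ_three, mul_pow, algebraMap_eq, C_mul, C_pow, pow_add, pow_mul]
      simp
      ring
    rw [h, coeff_monomial, coeff_monomial]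
    split_ifs with hu
    · rw [hu]
    · simp

/-- A polynomial in characteristic zero is determined by its constant term and its partial
derivatives. -/
theorem ext_constantCoeff_pderiv {ι : Type*} {p q : MvPolynomial ι ℂ}
    (h0 : constantCoeff p = constantCoeff q) (h : ∀ i, pderiv i p = pderiv i q) : p = q := by
  ext m
  by_cases hm : m = 0
  · simpa [hm, constantCoeff_eq] using h0
  · obtain ⟨i, hi⟩ := DFunLike.ne_iff.mp hm
    have hc := congrArg (coeff (m - Finsupp.single i 1)) (h i)
    rw [coeff_pderiv, coeff_pderiv, Finsupp.sub_add_single_one_cancel hi] at hc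
    exact mul_right_cancel₀ (Nat.cast_add_one_ne_zero _) hc

theorem Hinv3.pderiv_add_one {P : MvPolynomial (Fin 3) ℂ} (hH : Hinv3 P) (k : Fin 3) :
    pderiv (k + 1) P = sigma3 (pderiv k P) := by
  rw [← jb3_add_one_add_two, ← jb3_add_one_add_two, ← (hH (k + 1) (k + 2)).1,
    add_right_comm k 1 2]

theorem Hinv3.tau3_pderiv {P : MvPolynomial (Fin 3) ℂ} (hH : Hinv3 P) (k : Fin 3) :
    tau3 (pderiv k P) =
      eps3 ^ (((k + 1 : Fin 3) : ℕ) + ((k + 2 : Fin 3) : ℕ)) • pderiv k P := by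
  rw [← jb3_add_one_add_two]
  exact (hH (k + 1) (k + 2)).2

theorem Hinv3.sigma3_eq {P : MvPolynomial (Fin 3) ℂ} (hH : Hinv3 P) : sigma3 P = P := by
  refine ext_constantCoeff_pderiv (constantCoeff_rename _ P) fun k => ?_
  obtain ⟨j, rfl⟩ : ∃ j : Fin 3, j + 1 = k := ⟨k - 1, sub_add_cancel k 1⟩
  rw [hH.pderiv_add_one j]
  exact pderiv_rename (add_left_injective 1) j P

theorem Hinv3.tauDegree_eq_zero {P : MvPolynomial (Fin 3) ℂ} (hH : Hinv3 P) {m : Fin 3 →₀ ℕ}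
    (hm : m ∈ P.support) : (m 1 + 2 * m 2) % 3 = 0 := by
  by_cases h0 : m = 0
  · simp [h0]
  · obtain ⟨k, hk⟩ := DFunLike.ne_iff.mp h0
    obtain ⟨n, rfl⟩ : ∃ n, n + Finsupp.single k 1 = m :=
      ⟨_, Finsupp.sub_add_single_one_cancel hk⟩
    have hne : coeff n (pderiv k P) ≠ 0 := by
      rw [coeff_pderiv]
      exact mul_ne_zero (mem_support_iff.mp hm) (Nat.cast_add_one_ne_zero _)
    have hc := congrArg (coeff n) (hH.tau3_pderiv k)
    rw [coeff_tau3, coeff_smul, smul_eq_mul] at hc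
    have hfin : IsOfFinOrder eps3 :=
      isOfFinOrder_iff_pow_eq_one.mpr ⟨3, by norm_num, eps3_isPrimitiveRoot.pow_eq_one⟩
    have hmod := hfin.pow_eq_pow_iff_modEq.mp (mul_right_cancel₀ hne hc)
    rw [← eps3_isPrimitiveRoot.eq_orderOf, Nat.ModEq] at hmod
    fin_cases k <;> simp at hmod ⊢ <;> omega

/-- If `P` is homogeneous and `π(P)` is H-invariant, then `σ·P = P` and
every monomial `x₀^{a₀}x₁^{a₁}x₂^{a₂}` of `P` has τ-degree `0`, i.e. `a₁ + 2a₂ ≡ 0 (mod 3)`. -/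
theorem stmt_0 (P : MvPolynomial (Fin 3) ℂ) (hhom : ∃ d : ℕ, P.IsHomogeneous d)
    (hH : Hinv3 P) :
    sigma3 P = P ∧ ∀ m ∈ P.support, (m 1 + 2 * m 2) % 3 = 0 :=
  ⟨hH.sigma3_eq, fun _ hm => hH.tauDegree_eq_zero hm⟩
end

section
/- Let i be a positive integer not divisible by 3. Then 𝓗_i = 0; that is, the only homogeneous polynomial of total degree i in ℂ[x₀,x₁,x₂] whose Jacobian Poisson structure is H-invariant is the zero polynomial. -/
open MvPolynomial

/-- Substituting uniformly scaled values into a homogeneous polynomial of degree `n`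
scales the result by the `n`-th power of the factor. -/
theorem MvPolynomial.IsHomogeneous.aeval_C_mul {ι κ R : Type*} [CommSemiring R]
    {p : MvPolynomial ι R} {n : ℕ} (hp : p.IsHomogeneous n) (c : R) (g : ι → MvPolynomial κ R) :
    MvPolynomial.aeval (fun i => C c * g i) p = C (c ^ n) * MvPolynomial.aeval g p := by
  rw [aeval_def, aeval_def, eval₂_eq, eval₂_eq, Finset.mul_sum]
  refine Finset.sum_congr rfl fun d hd => ?_
  have hdeg : ∑ i ∈ d.support, d i = n := (hp.degree_eq_sum_deg_support hd).symm
  simp_rw [mul_pow, Finset.prod_mul_distrib, Finset.prod_pow_eq_pow_sum, hdeg, map_pow]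
  ring

theorem Hinv3.sigma3_pderiv {P : MvPolynomial (Fin 3) ℂ} (hH : Hinv3 P) (k : Fin 3) :
    sigma3 (pderiv k P) = pderiv (k + 1) P := by
  have h := (hH (k + 1) (k + 2)).1
  fin_cases k <;> simpa [jb3] using h.symm

theorem Hinv3.tau3_X_mul_pderiv {P : MvPolynomial (Fin 3) ℂ} (hH : Hinv3 P) (k : Fin 3) :
    tau3 (X k * pderiv k P) = X k * pderiv k P := by
  have hD : tau3 (pderiv k P) =
      C (eps3 ^ (((k + 1 : Fin 3) : ℕ) + ((k + 2 : Fin 3) : ℕ))) * pderiv k P := by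
    have h := (hH (k + 1) (k + 2)).2
    rw [smul_eq_C_mul] at h
    fin_cases k <;> simpa [jb3] using h
  have hX : tau3 (X k) = C (eps3 ^ (k : ℕ)) * X k := aeval_X _ k
  have hε : eps3 ^ (k : ℕ) * eps3 ^ (((k + 1 : Fin 3) : ℕ) + ((k + 2 : Fin 3) : ℕ)) = 1 := by
    rw [← pow_add, eps3_isPrimitiveRoot.pow_eq_one_iff_dvd]
    fin_cases k <;> decide
  rw [map_mul, hX, hD, mul_mul_mul_comm, ← map_mul, hε, map_one, one_mul]

/-- The automorphisms `σ` and `τ` commute up to scaling every variable by `ε`. -/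
theorem tau3_sigma3_of_isHomogeneous {P : MvPolynomial (Fin 3) ℂ} {n : ℕ}
    (hP : P.IsHomogeneous n) :
    tau3 (sigma3 P) = C (eps3 ^ n) * sigma3 (tau3 P) := by
  have h3 : (C eps3 : MvPolynomial (Fin 3) ℂ) ^ 3 = 1 := by
    rw [← map_pow, eps3_isPrimitiveRoot.pow_eq_one, map_one]
  have hst : sigma3.comp tau3 = aeval fun i => sigma3 (tau3 (X i)) :=
    algHom_ext fun i => by simp
  have hts : tau3.comp sigma3 = aeval fun i => C eps3 * sigma3 (tau3 (X i)) := by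
    refine algHom_ext fun i => ?_
    fin_cases i
    · simp [tau3, sigma3]
    · simp [tau3, sigma3]
      ring
    · simp [tau3, sigma3]
      linear_combination -(X 0) * h3
  calc tau3 (sigma3 P) = (tau3.comp sigma3) P := rfl
    _ = C (eps3 ^ n) * (sigma3.comp tau3) P := by rw [hts, hP.aeval_C_mul, hst]

theorem Hinv3.sigma3_eq_self {P : MvPolynomial (Fin 3) ℂ} (hH : Hinv3 P) {n : ℕ} (hn : n ≠ 0)
    (hP : P.IsHomogeneous n) : sigma3 P = P := by
  have h : n • sigma3 P = n • P := by
    rw [← map_nsmul, ← hP.sum_X_mul_pderiv, map_sum,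
      ← Equiv.sum_comp (Equiv.addRight (1 : Fin 3)) fun i => X i * pderiv i P]
    refine Finset.sum_congr rfl fun k _ => ?_
    rw [map_mul, hH.sigma3_pderiv]
    simp [sigma3]
  exact nsmul_right_injective hn h

theorem Hinv3.tau3_eq_self {P : MvPolynomial (Fin 3) ℂ} (hH : Hinv3 P) {n : ℕ} (hn : n ≠ 0)
    (hP : P.IsHomogeneous n) : tau3 P = P := by
  have h : n • tau3 P = n • P := by
    rw [← map_nsmul, ← hP.sum_X_mul_pderiv, map_sum]
    exact Finset.sum_congr rfl fun k _ => hH.tau3_X_mul_pderiv k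
  exact nsmul_right_injective hn h

/-- if `3 ∤ i` (`i > 0`), the only homogeneous polynomial of degree `i`
with H-invariant Jacobian Poisson structure is `0`. -/
theorem stmt_2 (i : ℕ) (hi : 0 < i) (h3 : ¬ (3 ∣ i)) (P : MvPolynomial (Fin 3) ℂ)
    (hhom : P.IsHomogeneous i) (hH : Hinv3 P) : P = 0 := by
  have h := tau3_sigma3_of_isHomogeneous hhom
  rw [hH.sigma3_eq_self hi.ne' hhom, hH.tau3_eq_self hi.ne' hhom,
    hH.sigma3_eq_self hi.ne' hhom] at h
  by_contra hP
  have hC : (C (eps3 ^ i) : MvPolynomial (Fin 3) ℂ) = C 1 := by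
    rw [C_1]
    exact mul_right_cancel₀ hP (by rw [one_mul]; exact h.symm)
  exact h3 (eps3_isPrimitiveRoot.dvd_of_pow_eq_one i (C_injective _ _ hC))
end

section
/- Fix an integer r ≥ 1 and an integer α with 0 ≤ α ≤ r. The number of β ∈ ℕ such that (α,β) ∈ S_r equals (α+1) + ⌊α/2⌋; equivalently it equals (3α+2)/2 if α is even and (3α+1)/2 if α is odd. -/
/-- The triangle `T_r ⊂ ℝ²` cut out by `x+y ≤ 3r`, `2x+y ≤ 4r`, `-x-2y ≤ -2r`, `-x+y ≤ r`. -/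
def Tr (r : ℕ) : Set (ℝ × ℝ) :=
  {p | p.1 + p.2 ≤ 3 * r ∧ 2 * p.1 + p.2 ≤ 4 * r ∧ -p.1 - 2 * p.2 ≤ -(2 * r) ∧ -p.1 + p.2 ≤ r}

/-- For `α ≤ r`, the column of lattice points of `Tr r` over `α` is an interval. -/
theorem setOf_mem_Tr_eq_Icc {r α : ℕ} (hα : α ≤ r) :
    {β : ℕ | ((α : ℝ), (β : ℝ)) ∈ Tr r} = Finset.Icc (r - α / 2) (r + α) := by
  ext β
  simp only [Tr, Set.mem_ofPred_eq, Finset.coe_Icc, Set.mem_Icc]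
  constructor
  · rintro ⟨-, -, hlow, hupp⟩
    have hlow' : 2 * r ≤ α + 2 * β := by
      have : (2 * r : ℝ) ≤ α + 2 * β := by linarith
      exact_mod_cast this
    have hupp' : β ≤ r + α := by
      have : (β : ℝ) ≤ r + α := by linarith
      exact_mod_cast this
    omega
  · rintro ⟨hlow, hupp⟩
    have hlow' : (2 * r : ℝ) ≤ α + 2 * β := by
      have : 2 * r ≤ α + 2 * β := by omega
      exact_mod_cast this
    have hupp' : (β : ℝ) ≤ r + α := by exact_mod_cast hupp
    have hα' : (α : ℝ) ≤ r := by exact_mod_cast hα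
    refine ⟨?_, ?_, ?_, ?_⟩ <;> linarith

/-- for `0 ≤ α ≤ r`, the number of `β ∈ ℕ` with `(α,β) ∈ S_r = T_r ∩ ℕ²`
equals `(α+1) + ⌊α/2⌋`. -/
theorem stmt_7 (r : ℕ) (hr : 1 ≤ r) (α : ℕ) (hα : α ≤ r) :
    Set.ncard {β : ℕ | ((α : ℝ), (β : ℝ)) ∈ Tr r} = (α + 1) + α / 2 := by
  rw [setOf_mem_Tr_eq_Icc hα, Set.ncard_coe_finset, Nat.card_Icc]
  omega
end

section
/- For every integer r ≥ 1, the cardinality of S_r¹ = {(x,y) ∈ S_r : 0 ≤ x ≤ r} equals (3r²+6r+4)/4 if r is even and (3r²+6r+3)/4 if r is odd. -/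
theorem natCast_mem_Tr_and_le_iff (r x y : ℕ) :
    ((x : ℝ), (y : ℝ)) ∈ Tr r ∧ x ≤ r ↔ x ≤ r ∧ r - x / 2 ≤ y ∧ y ≤ r + x := by
  have h₁ : (x : ℝ) + y ≤ 3 * r ↔ x + y ≤ 3 * r := by norm_cast
  have h₂ : 2 * (x : ℝ) + y ≤ 4 * r ↔ 2 * x + y ≤ 4 * r := by norm_cast
  have h₃ : -(x : ℝ) - 2 * y ≤ -(2 * r) ↔ 2 * r ≤ x + 2 * y := by
    rw [← Nat.cast_le (α := ℝ)]
    push_cast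
    constructor <;> intro h <;> linarith
  have h₄ : -(x : ℝ) + y ≤ r ↔ y ≤ r + x := by
    rw [← Nat.cast_le (α := ℝ)]
    push_cast
    constructor <;> intro h <;> linarith
  simp only [Tr, Set.mem_ofPred_eq, h₁, h₂, h₃, h₄]
  omega

theorem sum_range_add_half_add_one (r : ℕ) :
    ∑ x ∈ Finset.range (r + 1), (x + x / 2 + 1) =
      if Even r then (3 * r ^ 2 + 6 * r + 4) / 4 else (3 * r ^ 2 + 6 * r + 3) / 4 := by
  have key : 4 * ∑ x ∈ Finset.range (r + 1), (x + x / 2 + 1) + r % 2 =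
      3 * r ^ 2 + 6 * r + 4 := by
    induction r with
    | zero => simp
    | succ n ih =>
      rw [Finset.sum_range_succ]
      ring_nf at ih ⊢
      omega
  split_ifs with h
  · rw [Nat.even_iff] at h
    omega
  · rw [Nat.even_iff] at h
    omega

/-- `card S_r¹ = (3r²+6r+4)/4` for even `r`, `(3r²+6r+3)/4` for odd `r`,
where `S_r¹ = {(x,y) ∈ T_r ∩ ℕ² : 0 ≤ x ≤ r}`. -/
theorem stmt_8 (r : ℕ) (hr : 1 ≤ r) :
    Set.ncard {p : ℕ × ℕ | ((p.1 : ℝ), (p.2 : ℝ)) ∈ Tr r ∧ p.1 ≤ r} =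
      if Even r then (3 * r ^ 2 + 6 * r + 4) / 4 else (3 * r ^ 2 + 6 * r + 3) / 4 := by
  have hset : {p : ℕ × ℕ | ((p.1 : ℝ), (p.2 : ℝ)) ∈ Tr r ∧ p.1 ≤ r} =
      (((Finset.range (r + 1)).sigma fun x => Finset.Icc (r - x / 2) (r + x)).map
        (Equiv.sigmaEquivProd ℕ ℕ).toEmbedding : Finset (ℕ × ℕ)) := by
    ext ⟨x, y⟩
    simp [natCast_mem_Tr_and_le_iff]
  rw [hset, Set.ncard_coe_finset, Finset.card_map, Finset.card_sigma,
    ← sum_range_add_half_add_one]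
  refine Finset.sum_congr rfl fun x hx => ?_
  rw [Finset.mem_range] at hx
  rw [Nat.card_Icc]
  omega
end

section
/- Fix an integer r ≥ 1 and an integer α with r < α ≤ 2r. The number of β ∈ ℕ such that (α,β) ∈ S_r equals (3r+1) − 2α + ⌊α/2⌋; equivalently it equals (6r+2−3α)/2 if α is even and (6r+1−3α)/2 if α is odd. -/
/-- Membership of a lattice point in `Tr r`, as inequalities between natural numbers. -/
theorem natCast_mem_Tr_iff (r a b : ℕ) :
    ((a : ℝ), (b : ℝ)) ∈ Tr r ↔
      a + b ≤ 3 * r ∧ 2 * a + b ≤ 4 * r ∧ 2 * r ≤ a + 2 * b ∧ b ≤ r + a := by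
  have h : -(a : ℝ) - 2 * b ≤ -(2 * r) ↔ 2 * (r : ℝ) ≤ a + 2 * b := by
    constructor <;> intro h <;> linarith
  have h' : -(a : ℝ) + b ≤ r ↔ (b : ℝ) ≤ r + a := by
    constructor <;> intro h <;> linarith
  simp only [Tr, Set.mem_ofPred_eq, h, h']
  norm_cast

/-- for `r < α ≤ 2r`, the number of `β ∈ ℕ` with `(α,β) ∈ S_r = T_r ∩ ℕ²`
equals `(3r+1) − 2α + ⌊α/2⌋`. -/
theorem stmt_9 (r : ℕ) (hr : 1 ≤ r) (α : ℕ) (h1 : r < α) (h2 : α ≤ 2 * r) :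
    (Set.ncard {β : ℕ | ((α : ℝ), (β : ℝ)) ∈ Tr r} : ℤ) =
      (3 * (r : ℤ) + 1) - 2 * (α : ℤ) + ((α / 2 : ℕ) : ℤ) := by
  have h : {β : ℕ | ((α : ℝ), (β : ℝ)) ∈ Tr r} =
      (Finset.Icc (r - α / 2) (4 * r - 2 * α) : Finset ℕ) := by
    ext β
    simp only [Set.mem_ofPred_eq, natCast_mem_Tr_iff, Finset.coe_Icc, Set.mem_Icc]
    omega
  rw [h, Set.ncard_coe_finset, Nat.card_Icc]
  omega
end

section
/- For every integer r ≥ 1, the cardinality of S_r² = {(x,y) ∈ S_r : r < x ≤ 2r} equals 3r²/4 if r is even and (3r²+1)/4 if r is odd. -/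
/-- A closed form for the sum of `⌊3j/2⌋ + 1` over `j < r`. -/
lemma four_mul_sum_range_three_mul_div_two_add_one (r : ℕ) :
    4 * ∑ j ∈ Finset.range r, (3 * j / 2 + 1) = 3 * r ^ 2 + r % 2 := by
  induction r with
  | zero => simp
  | succ n ih =>
    rw [Finset.sum_range_succ, mul_add, ih]
    have h : 3 * (n + 1) ^ 2 = 3 * n ^ 2 + 6 * n + 3 := by ring
    obtain ⟨k, hk | hk⟩ := n.even_or_odd' <;> omega

/-- The integer points of `Tr r` with `r < x ≤ 2r`, fibred over `j = 2r - x`: the fibre is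
`⌈j/2⌉ ≤ y ≤ 2j`. -/
lemma setOf_mem_Tr_eq_image (r : ℕ) :
    {p : ℕ × ℕ | ((p.1 : ℝ), (p.2 : ℝ)) ∈ Tr r ∧ r < p.1 ∧ p.1 ≤ 2 * r} =
      (fun q : (_ : ℕ) × ℕ => (2 * r - q.1, q.2)) ''
        ((Finset.range r).sigma fun j => Finset.Icc ((j + 1) / 2) (2 * j)) := by
  have mem_Tr_iff (x y : ℕ) : ((x : ℝ), (y : ℝ)) ∈ Tr r ↔
      x + y ≤ 3 * r ∧ 2 * x + y ≤ 4 * r ∧ 2 * r ≤ x + 2 * y ∧ y ≤ r + x := by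
    simp only [Tr, Set.mem_ofPred_eq, ← @Nat.cast_le ℝ]
    push_cast
    constructor <;> rintro ⟨h₁, h₂, h₃, h₄⟩ <;> refine ⟨?_, ?_, ?_, ?_⟩ <;> linarith
  ext ⟨x, y⟩
  simp only [Set.mem_ofPred_eq, mem_Tr_iff, Set.mem_image, Finset.mem_coe, Finset.mem_sigma,
    Finset.mem_range, Finset.mem_Icc, Prod.mk.injEq]
  constructor
  · intro h
    exact ⟨⟨2 * r - x, y⟩, by dsimp only; omega⟩
  · rintro ⟨⟨j, z⟩, h⟩
    dsimp only at h
    omega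

/-- `card S_r² = 3r²/4` for even `r`, `(3r²+1)/4` for odd `r`,
where `S_r² = {(x,y) ∈ T_r ∩ ℕ² : r < x ≤ 2r}`. -/
theorem stmt_10 (r : ℕ) (hr : 1 ≤ r) :
    Set.ncard {p : ℕ × ℕ | ((p.1 : ℝ), (p.2 : ℝ)) ∈ Tr r ∧ r < p.1 ∧ p.1 ≤ 2 * r} =
      if Even r then 3 * r ^ 2 / 4 else (3 * r ^ 2 + 1) / 4 := by
  have inj : Set.InjOn (fun q : (_ : ℕ) × ℕ => (2 * r - q.1, q.2))
      ((Finset.range r).sigma fun j => Finset.Icc ((j + 1) / 2) (2 * j)) := by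
    rintro ⟨j, y⟩ hj ⟨k, z⟩ hk h
    simp only [Finset.mem_coe, Finset.mem_sigma, Finset.mem_range, Prod.mk.injEq] at hj hk h
    obtain ⟨h, rfl⟩ := h
    obtain rfl : j = k := by omega
    rfl
  rw [setOf_mem_Tr_eq_image, inj.ncard_image, Set.ncard_coe_finset,
    Finset.card_sigma]
  have card_fibre (j : ℕ) : (Finset.Icc ((j + 1) / 2) (2 * j)).card = 3 * j / 2 + 1 := by
    rw [Nat.card_Icc]
    omega
  simp only [card_fibre]
  have h := four_mul_sum_range_three_mul_div_two_add_one r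
  split_ifs with hr₂
  · rw [Nat.even_iff] at hr₂
    omega
  · rw [Nat.not_even_iff] at hr₂
    omega
end

section
/- For every integer r ≥ 1, the number of points of ℕ² lying in the triangle T_r equals (3r² + 3r + 2)/2. -/
theorem mem_Tr_natCast_iff (r x y : ℕ) :
    ((x : ℝ), (y : ℝ)) ∈ Tr r ↔
      x + y ≤ 3 * r ∧ 2 * x + y ≤ 4 * r ∧ 2 * r ≤ x + 2 * y ∧ y ≤ r + x := by
  simp only [Tr, Set.mem_ofPred_eq]
  have h : (2 * r ≤ x + 2 * y ↔ -(x : ℝ) - 2 * y ≤ -(2 * r)) := by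
    rw [← Nat.cast_le (α := ℝ)]
    push_cast
    constructor <;> intro h <;> linarith
  have h' : (y ≤ r + x ↔ -(x : ℝ) + y ≤ r) := by
    rw [← Nat.cast_le (α := ℝ)]
    push_cast
    constructor <;> intro h <;> linarith
  rw [← h, ← h']
  norm_cast

/-- The lattice points of `T_r`, listed column by column. -/
def trColumns (r : ℕ) : Finset (Σ _ : ℕ, ℕ) :=
  (Finset.range (r + 1 + r)).sigma
    fun x => Finset.Icc ((2 * r - x + 1) / 2) (min (r + x) (4 * r - 2 * x))

theorem setOf_mem_Tr_eq_map_trColumns (r : ℕ) :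
    {p : ℕ × ℕ | ((p.1 : ℝ), (p.2 : ℝ)) ∈ Tr r} =
      ((trColumns r).map (Equiv.sigmaEquivProd ℕ ℕ).toEmbedding : Finset (ℕ × ℕ)) := by
  ext ⟨x, y⟩
  rw [Set.mem_ofPred_eq, mem_Tr_natCast_iff, Finset.mem_coe, Finset.mem_map_equiv]
  simp only [trColumns, Equiv.sigmaEquivProd_symm_apply, Finset.mem_sigma, Finset.mem_range,
    Finset.mem_Icc]
  omega

theorem two_mul_sum_column_card (r : ℕ) :
    2 * (∑ x ∈ Finset.range (r + 1), (x + x / 2 + 1) + ∑ x ∈ Finset.range r, (x + x / 2 + 1)) =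
      3 * r ^ 2 + 3 * r + 2 := by
  induction r with
  | zero => simp
  | succ r ih =>
    rw [Finset.sum_range_succ _ (r + 1), Finset.sum_range_succ _ r] at *
    have h : (r + 1) / 2 + r / 2 = r := by omega
    linarith

theorem card_trColumns (r : ℕ) :
    (trColumns r).card =
      ∑ x ∈ Finset.range (r + 1), (x + x / 2 + 1) + ∑ x ∈ Finset.range r, (x + x / 2 + 1) := by
  rw [trColumns, Finset.card_sigma, Finset.sum_range_add,
    ← Finset.sum_range_reflect (fun x => x + x / 2 + 1) r]
  congr 1 <;> refine Finset.sum_congr rfl fun x hx => ?_ <;>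
    rw [Finset.mem_range] at hx <;> rw [Nat.card_Icc] <;> omega

/-- the number of points of `ℕ²` in the triangle `T_r` is `(3r²+3r+2)/2`. -/
theorem stmt_11 (r : ℕ) (hr : 1 ≤ r) :
    Set.ncard {p : ℕ × ℕ | ((p.1 : ℝ), (p.2 : ℝ)) ∈ Tr r} = (3 * r ^ 2 + 3 * r + 2) / 2 := by
  rw [setOf_mem_Tr_eq_map_trColumns, Set.ncard_coe_finset, Finset.card_map, card_trColumns,
    ← two_mul_sum_column_card, Nat.mul_div_cancel_left _ two_pos]
end

section
/- Fix n ≥ 3, an integer r ≥ 1, and set l = n/2 if n is even and l = 0 if n is odd. Suppose (α₀,…,α_{n−1}) ∈ ℕⁿ and integers s₀,…,s_{n−1} satisfy α₀+α₁+⋯+α_{n−1} = nr and, for each k ∈ {0,…,n−1}, Σ_{j=0}^{n−1} ((j+k) mod n)·α_j = l + n·s_k. Then α_i = s_{n−i−1} − s_{n−i} + r for every i (indices of s taken modulo n), and s₀ + s₁ + ⋯ + s_{n−1} = n(n−1)r/2 − l. -/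
/-- `l = n/2` if `n` is even, `l = 0` if `n` is odd. -/
def lN (n : ℕ) : ℕ := if Even n then n / 2 else 0

theorem fin_coe_add_one {n : ℕ} [NeZero n] (m : Fin n) :
    (((m + 1 : Fin n) : ℕ) : ℤ) = (m : ℕ) + 1 - if m + 1 = 0 then (n : ℤ) else 0 := by
  obtain ⟨n, rfl⟩ := Nat.exists_eq_succ_of_ne_zero (NeZero.ne n)
  have hlast : m + 1 = 0 ↔ m = Fin.last n := by
    rw [← Fin.last_add_one, add_left_inj]
  simp only [Fin.val_add_one, hlast]
  split_ifs with h
  · simp [h]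
  · simp

theorem sum_fin_coe_add_left {n : ℕ} [NeZero n] (j : Fin n) :
    ∑ k : Fin n, (((j + k : Fin n) : ℕ) : ℤ) = ((n * (n - 1) / 2 : ℕ) : ℤ) := by
  refine (Equiv.sum_comp (Equiv.addLeft j) fun k : Fin n => ((k : ℕ) : ℤ)).trans ?_
  rw [Fin.sum_univ_eq_sum_range fun k : ℕ => (k : ℤ), ← Nat.cast_sum, Finset.sum_range_id]

/-- if `(α₀,…,α_{n−1}) ∈ ℕⁿ` and integers `s₀,…,s_{n−1}` satisfy
`∑ αᵢ = nr` and, for each `k`, `∑_j ((j+k) mod n)·α_j = l + n·s_k`, then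
`α_i = s_{n−i−1} − s_{n−i} + r` for all `i` (indices of `s` mod `n`) and
`∑ s_k = n(n−1)r/2 − l`. -/
theorem stmt_17 (n : ℕ) [NeZero n] (hn : 3 ≤ n) (r : ℤ) (hr : 1 ≤ r)
    (α : Fin n → ℤ) (hα : ∀ i, 0 ≤ α i) (s : Fin n → ℤ)
    (hsum : ∑ i : Fin n, α i = n * r)
    (heq : ∀ k : Fin n, ∑ j : Fin n, ((((j : ℕ) + (k : ℕ)) % n : ℕ) : ℤ) * α j
      = (lN n : ℤ) + n * s k) :
    (∀ i : Fin n, α i = s (-(i + 1)) - s (-i) + r) ∧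
    ∑ k : Fin n, s k = ((n * (n - 1) / 2 : ℕ) : ℤ) * r - (lN n : ℤ) := by
  have hn0 : (n : ℤ) ≠ 0 := Nat.cast_ne_zero.mpr (NeZero.ne n)
  simp only [← Fin.val_add] at heq
  refine ⟨fun i => ?_, ?_⟩
  · have hi : ∀ j : Fin n, j + -(i + 1) + 1 = 0 ↔ j = i := fun j => by
      rw [show j + -(i + 1) + 1 = j - i by abel, sub_eq_zero]
    have hstep : ∑ j : Fin n, (((j + -i : Fin n) : ℕ) : ℤ) * α j
        = ∑ j : Fin n, (((j + -(i + 1) : Fin n) : ℕ) : ℤ) * α j + n * r - n * α i := by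
      have hterm : ∀ j : Fin n, (((j + -i : Fin n) : ℕ) : ℤ) * α j
          = (((j + -(i + 1) : Fin n) : ℕ) : ℤ) * α j + α j
            - if j = i then n * α j else 0 := fun j => by
        rw [show j + -i = j + -(i + 1) + 1 by abel, fin_coe_add_one]
        simp only [hi]
        split_ifs <;> ring
      simp only [hterm, Finset.sum_sub_distrib, Finset.sum_add_distrib, hsum,
        Finset.sum_ite_eq', Finset.mem_univ, if_true]
    rw [heq, heq] at hstep
    apply mul_left_cancel₀ hn0
    linarith
  · have htotal : ∑ k : Fin n, ∑ j : Fin n, (((j + k : Fin n) : ℕ) : ℤ) * α j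
        = ((n * (n - 1) / 2 : ℕ) : ℤ) * (n * r) := by
      rw [Finset.sum_comm]
      simp only [← Finset.sum_mul, sum_fin_coe_add_left]
      rw [← Finset.mul_sum, hsum]
    simp only [heq, Finset.sum_add_distrib, ← Finset.mul_sum, Finset.sum_const,
      Finset.card_univ, Fintype.card_fin, nsmul_eq_mul] at htotal
    apply mul_left_cancel₀ hn0
    linarith
end

section
/- Fix n ≥ 3 and let (f_{i,j})_{i,j ∈ ℤ/nℤ} be a family of polynomials in ℂ[x₀,…,x_{n−1}] satisfying the H-invariance conditions f_{i+1,j+1} = σ·f_{i,j} and τ·f_{i,j} = ε^{i+j}·f_{i,j} for all i,j ∈ ℤ/nℤ. Then every monomial occurring in any f_{i,j} has total degree congruent to 2 modulo n; i.e. each such degree equals 2 + sn for some s ∈ ℕ. -/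
open MvPolynomial

/-- The primitive `n`-th root of unity `ε = e^{2πi/n}`. -/
noncomputable def epsN (n : ℕ) : ℂ := Complex.exp (2 * Real.pi * Complex.I / n)

/-- The algebra automorphism `σ` of `ℂ[x₀,…,x_{n-1}]` with `σ(x_i) = x_{i+1 mod n}`. -/
noncomputable def sigmaN (n : ℕ) [NeZero n] :
    MvPolynomial (Fin n) ℂ →ₐ[ℂ] MvPolynomial (Fin n) ℂ :=
  rename (fun i : Fin n => i + 1)

/-- The algebra endomorphism `τ` of `ℂ[x₀,…,x_{n-1}]` with `τ(x_i) = ε^i x_i`. -/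
noncomputable def tauN (n : ℕ) : MvPolynomial (Fin n) ℂ →ₐ[ℂ] MvPolynomial (Fin n) ℂ :=
  aeval (fun i : Fin n => C (epsN n ^ (i : ℕ)) * X i)

/-- `P` is `τ`-homogeneous of `τ`-degree `d`: every monomial `∏ xᵢ^{aᵢ}` of `P`
satisfies `∑ i·aᵢ ≡ d (mod n)`. -/
def TauHom (n : ℕ) (P : MvPolynomial (Fin n) ℂ) (d : ℕ) : Prop :=
  ∀ m ∈ P.support, (∑ i : Fin n, (i : ℕ) * m i) % n = d

/-- The Jacobian Poisson bracket `{f,g}` attached to the Casimirs `P₁,…,P_{n-2}`: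
the determinant of the Jacobian matrix of `(f, g, P₁, …, P_{n-2})` with respect to
`(x₀, …, x_{n-1})`. -/
noncomputable def jbN (n : ℕ) (P : Fin (n - 2) → MvPolynomial (Fin n) ℂ)
    (f g : MvPolynomial (Fin n) ℂ) : MvPolynomial (Fin n) ℂ :=
  Matrix.det (Matrix.of fun i j : Fin n =>
    if h0 : (i : ℕ) = 0 then pderiv j f
    else if h1 : (i : ℕ) = 1 then pderiv j g
    else pderiv j (P ⟨(i : ℕ) - 2, by have := i.isLt; omega⟩))

/-- The Jacobian Poisson structure `π(P₁,…,P_{n-2})` is Heisenberg-invariant. -/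
def HinvN (n : ℕ) [NeZero n] (P : Fin (n - 2) → MvPolynomial (Fin n) ℂ) : Prop :=
  ∀ i j : Fin n,
    jbN n P (X (i + 1)) (X (j + 1)) = sigmaN n (jbN n P (X i) (X j)) ∧
    tauN n (jbN n P (X i) (X j)) = epsN n ^ ((i : ℕ) + (j : ℕ)) • jbN n P (X i) (X j)

theorem isPrimitiveRoot_epsN (n : ℕ) [NeZero n] : IsPrimitiveRoot (epsN n) n :=
  Complex.isPrimitiveRoot_exp n (NeZero.ne n)

/-- `τ` acts diagonally on monomials. -/
theorem coeff_tauN (n : ℕ) (p : MvPolynomial (Fin n) ℂ) (m : Fin n →₀ ℕ) :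
    coeff m (tauN n p) = epsN n ^ (∑ k : Fin n, (k : ℕ) * m k) * coeff m p := by
  induction p using MvPolynomial.induction_on' with
  | monomial u a =>
    have h : tauN n (monomial u a) =
        monomial u (epsN n ^ (∑ k : Fin n, (k : ℕ) * u k) * a) := by
      rw [tauN, aeval_monomial, Finsupp.prod_fintype _ _ (by simp)]
      simp only [mul_pow, Finset.prod_mul_distrib, ← C_pow, ← pow_mul]
      rw [← map_prod, Finset.prod_pow_eq_pow_sum, monomial_eq, C_mul,
        Finsupp.prod_fintype _ _ (by simp), algebraMap_eq]
      ring
    rw [h, coeff_monomial, coeff_monomial]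
    split_ifs with hu
    · rw [hu]
    · simp
  | add p q hp hq => rw [map_add, coeff_add, coeff_add, hp, hq, mul_add]

/-- A monomial of a `τ`-eigenvector with eigenvalue `ε ^ d` has `τ`-degree `d` modulo `n`. -/
theorem weight_eq_of_tauN_eq_smul (n : ℕ) [NeZero n] {p : MvPolynomial (Fin n) ℂ} {d : ℕ}
    (hp : tauN n p = epsN n ^ d • p) {m : Fin n →₀ ℕ} (hm : m ∈ p.support) :
    (∑ k : Fin n, ((k : ℕ) : ZMod n) * (m k : ZMod n)) = d := by
  have h := congrArg (coeff m) hp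
  rw [coeff_tauN, coeff_smul, smul_eq_mul] at h
  have h' := mul_right_cancel₀ (mem_support_iff.mp hm) h
  have hε := isPrimitiveRoot_epsN n
  have hn : 0 < n := NeZero.pos n
  rw [pow_eq_pow_mod _ hε.pow_eq_one, pow_eq_pow_mod d hε.pow_eq_one] at h'
  have h'' := (ZMod.natCast_eq_natCast_iff _ _ n).mpr
    (hε.pow_inj (Nat.mod_lt _ hn) (Nat.mod_lt _ hn) h')
  exact_mod_cast h''

theorem natCast_val_add_one (n : ℕ) [NeZero n] (k : Fin n) :
    (((k + 1 : Fin n) : ℕ) : ZMod n) = ((k : ℕ) : ZMod n) + 1 := by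
  rw [Fin.val_add, ZMod.natCast_mod, Nat.cast_add, Fin.val_one', ZMod.natCast_mod, Nat.cast_one]

/-- if the family `(f_{i,j})` satisfies the H-invariance conditions
`f_{i+1,j+1} = σ·f_{i,j}` and `τ·f_{i,j} = ε^{i+j}·f_{i,j}`, then every monomial
occurring in any `f_{i,j}` has total degree `2 + sn` for some `s ∈ ℕ`. -/
theorem stmt_19 (n : ℕ) [NeZero n] (hn : 3 ≤ n)
    (f : Fin n → Fin n → MvPolynomial (Fin n) ℂ)
    (hσ : ∀ i j : Fin n, f (i + 1) (j + 1) = sigmaN n (f i j))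
    (hτ : ∀ i j : Fin n, tauN n (f i j) = epsN n ^ ((i : ℕ) + (j : ℕ)) • f i j) :
    ∀ i j : Fin n, ∀ m ∈ (f i j).support, ∃ s : ℕ, (∑ k : Fin n, m k) = 2 + s * n := by
  intro i j m hm
  have hinj : Function.Injective (fun k : Fin n => k + 1) := add_left_injective 1
  have h₁ := weight_eq_of_tauN_eq_smul n (hτ i j) hm
  have hm' : m.mapDomain (fun k : Fin n => k + 1) ∈ (f (i + 1) (j + 1)).support := by
    rw [hσ, sigmaN, mem_support_iff, coeff_rename_mapDomain _ hinj]
    exact mem_support_iff.mp hm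
  have h₂ := weight_eq_of_tauN_eq_smul n (hτ (i + 1) (j + 1)) hm'
  rw [← Equiv.sum_comp (Equiv.addRight (1 : Fin n))] at h₂
  simp only [Equiv.coe_addRight, Finsupp.mapDomain_apply hinj, natCast_val_add_one,
    Nat.cast_add, add_mul, one_mul, Finset.sum_add_distrib] at h₁ h₂
  have h : ((∑ k : Fin n, m k : ℕ) : ZMod n) = ((2 : ℕ) : ZMod n) := by
    push_cast
    linear_combination h₂ - h₁
  rw [ZMod.natCast_eq_natCast_iff, Nat.ModEq, Nat.mod_eq_of_lt (show 2 < n by omega)] at h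
  refine ⟨(∑ k : Fin n, m k) / n, ?_⟩
  rw [← h, Nat.mod_add_div']
end
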